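/- arXiv:1911.08532 — 2 statements merged into one kernel-verified Lean document; each statement's English description precedes it below -/
import Mathlib

section
/- Suppose β ≤ 0.4 and Conditions 1, 2 and 3 hold. Let B' ⊆ B satisfy |B' ∩ B_G| ≥ (1 − β/6)|B_G|, and suppose ψ(B') = t·κ_G for some t ≥ 0. Then ||p̄_{B'} − p||₁ ≤ (10 + 3√t)·β·√(ln(6e/β)/n). -/
open Finset

noncomputable def emp {m n k : ℕ} (X : Fin m → Fin n → Fin k)
    (b : Fin m) (S : Finset (Fin k)) : ℝ :=
  (∑ i : Fin n, if X b i ∈ S then (1 : ℝ) else 0) / (n : ℝ)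

noncomputable def pbar {m n k : ℕ} (X : Fin m → Fin n → Fin k)
    (B' : Finset (Fin m)) (S : Finset (Fin k)) : ℝ :=
  (∑ b ∈ B', emp X b S) / (B'.card : ℝ)

noncomputable def probS {k : ℕ} (p : Fin k → ℝ) (S : Finset (Fin k)) : ℝ :=
  ∑ i ∈ S, p i

noncomputable def Vf (n : ℕ) (r : ℝ) : ℝ := r * (1 - r) / (n : ℝ)

noncomputable def medOf {m n k : ℕ} (X : Fin m → Fin n → Fin k)
    (S : Finset (Fin k)) : ℝ :=
  ((Finset.univ.val.map fun b : Fin m => emp X b S).sort (· ≤ ·)).getD (m / 2) 0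

noncomputable def score {m n k : ℕ} (β : ℝ) (X : Fin m → Fin n → Fin k)
    (b : Fin m) (S : Finset (Fin k)) : ℝ :=
  if |emp X b S - medOf X S| ≤ 3 * Real.sqrt (Real.log (6 * Real.exp 1 / β) / (n : ℝ))
  then 0 else (emp X b S - medOf X S) ^ 2

noncomputable def psi {m n k : ℕ} (β : ℝ) (X : Fin m → Fin n → Fin k)
    (B' : Finset (Fin m)) (S : Finset (Fin k)) : ℝ :=
  ∑ b ∈ B', score β X b S

noncomputable def psiMax {m n k : ℕ} (β : ℝ) (X : Fin m → Fin n → Fin k)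
    (B' : Finset (Fin m)) : ℝ :=
  Finset.univ.sup' Finset.univ_nonempty fun S : Finset (Fin k) => psi β X B' S

noncomputable def Vbar {m n k : ℕ} (X : Fin m → Fin n → Fin k)
    (B' : Finset (Fin m)) (S : Finset (Fin k)) : ℝ :=
  (∑ b ∈ B', (emp X b S - pbar X B' S) ^ 2) / (B'.card : ℝ)

noncomputable def kappaG (β : ℝ) (m n : ℕ) : ℝ :=
  β * (m : ℝ) * Real.log (6 * Real.exp 1 / β) / (n : ℝ)

def Cond1 {m n k : ℕ} (X : Fin m → Fin n → Fin k) (p : Fin k → ℝ) : Prop :=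
  ∀ S : Finset (Fin k), |medOf X S - probS p S| ≤ Real.sqrt (Real.log 6 / (n : ℝ))

def Cond2 {m n k : ℕ} (β : ℝ) (X : Fin m → Fin n → Fin k) (p : Fin k → ℝ)
    (BG : Finset (Fin m)) : Prop :=
  ∀ S : Finset (Fin k), ∀ B'G ⊆ BG, (1 - β / 6) * (BG.card : ℝ) ≤ (B'G.card : ℝ) →
    |pbar X B'G S - probS p S| ≤
      (β / 2) * Real.sqrt (Real.log (6 * Real.exp 1 / β) / (n : ℝ)) ∧
    |(∑ b ∈ B'G, (emp X b S - probS p S) ^ 2) / (B'G.card : ℝ) - Vf n (probS p S)| ≤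
      6 * β * Real.log (6 * Real.exp 1 / β) / (n : ℝ)

def Cond3 {m n k : ℕ} (β : ℝ) (X : Fin m → Fin n → Fin k)
    (BG : Finset (Fin m)) : Prop :=
  ∀ S : Finset (Fin k), psi β X BG S ≤ kappaG β m n

theorem sum_emp_singleton {m n k : ℕ} (X : Fin m → Fin n → Fin k) (b : Fin m)
    (S : Finset (Fin k)) : ∑ i ∈ S, emp X b {i} = emp X b S := by
  unfold emp
  rw [← Finset.sum_div, Finset.sum_comm]
  simp [Finset.mem_singleton]

theorem sum_pbar_singleton {m n k : ℕ} (X : Fin m → Fin n → Fin k) (B' : Finset (Fin m))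
    (S : Finset (Fin k)) : ∑ i ∈ S, pbar X B' {i} = pbar X B' S := by
  unfold pbar
  rw [← Finset.sum_div, Finset.sum_comm]
  simp_rw [sum_emp_singleton]

/-- The `ℓ¹` distance is at most twice any uniform bound on the differences over subsets. -/
theorem sum_abs_le_two_mul_of_forall_abs_sum_le {ι : Type*} [Fintype ι] (f : ι → ℝ) {C : ℝ}
    (h : ∀ S : Finset ι, |∑ i ∈ S, f i| ≤ C) : ∑ i, |f i| ≤ 2 * C := by
  have hsplit := Finset.sum_filter_add_sum_filter_not Finset.univ (fun i => 0 ≤ f i)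
    (fun i => |f i|)
  have hpos : ∑ i with 0 ≤ f i, |f i| = ∑ i with 0 ≤ f i, f i :=
    Finset.sum_congr rfl fun i hi => abs_of_nonneg (Finset.mem_filter.1 hi).2
  have hneg : ∑ i with ¬ 0 ≤ f i, |f i| = -∑ i with ¬ 0 ≤ f i, f i := by
    rw [← Finset.sum_neg_distrib]
    exact Finset.sum_congr rfl fun i hi =>
      abs_of_nonpos (not_le.1 (Finset.mem_filter.1 hi).2).le
  have h₁ := (abs_le.1 (h (Finset.univ.filter fun i => 0 ≤ f i))).2
  have h₂ := (abs_le.1 (h (Finset.univ.filter fun i => ¬ 0 ≤ f i))).1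
  linarith

theorem score_nonneg {m n k : ℕ} (β : ℝ) (X : Fin m → Fin n → Fin k) (b : Fin m)
    (S : Finset (Fin k)) : 0 ≤ score β X b S := by
  unfold score
  split_ifs
  · exact le_rfl
  · positivity

theorem abs_emp_sub_medOf_le {m n k : ℕ} (β : ℝ) (X : Fin m → Fin n → Fin k) (b : Fin m)
    (S : Finset (Fin k)) :
    |emp X b S - medOf X S| ≤
      3 * Real.sqrt (Real.log (6 * Real.exp 1 / β) / (n : ℝ)) + Real.sqrt (score β X b S) := by
  unfold score
  split_ifs with h
  · simpa using h
  · rw [Real.sqrt_sq_eq_abs]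
    linarith [Real.sqrt_nonneg (Real.log (6 * Real.exp 1 / β) / (n : ℝ))]

theorem log_six_le {β : ℝ} (hβ0 : 0 < β) (hβ : β ≤ 1) :
    Real.log 6 ≤ Real.log (6 * Real.exp 1 / β) := by
  apply Real.log_le_log (by norm_num)
  rw [le_div_iff₀ hβ0]
  nlinarith [Real.add_one_le_exp (1 : ℝ)]

theorem sum_sqrt_score_le {m n k : ℕ} (β : ℝ) (X : Fin m → Fin n → Fin k)
    (A : Finset (Fin m)) (S : Finset (Fin k)) :
    ∑ b ∈ A, Real.sqrt (score β X b S) ≤ Real.sqrt (A.card * psi β X A S) := by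
  apply Real.le_sqrt_of_sq_le
  refine sq_sum_le_card_mul_sum_sq.trans_eq ?_
  simp only [psi, Real.sq_sqrt (score_nonneg β X _ S)]

/-- Total deviation over an arbitrary collection of batches, in terms of its corruption score. -/
theorem abs_sum_emp_sub_le {m n k : ℕ} {β : ℝ} (hβ0 : 0 < β) (hβ : β ≤ 1)
    {X : Fin m → Fin n → Fin k} {p : Fin k → ℝ} (h1 : Cond1 X p)
    (A : Finset (Fin m)) (S : Finset (Fin k)) :
    |∑ b ∈ A, (emp X b S - probS p S)| ≤
      A.card * (4 * Real.sqrt (Real.log (6 * Real.exp 1 / β) / (n : ℝ))) +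
        Real.sqrt (A.card * psi β X A S) := by
  have hmed : |medOf X S - probS p S| ≤
      Real.sqrt (Real.log (6 * Real.exp 1 / β) / (n : ℝ)) :=
    (h1 S).trans (Real.sqrt_le_sqrt
      (div_le_div_of_nonneg_right (log_six_le hβ0 hβ) (Nat.cast_nonneg n)))
  calc |∑ b ∈ A, (emp X b S - probS p S)|
      ≤ ∑ b ∈ A, |emp X b S - probS p S| := Finset.abs_sum_le_sum_abs _ _
    _ ≤ ∑ b ∈ A, (4 * Real.sqrt (Real.log (6 * Real.exp 1 / β) / (n : ℝ)) +
          Real.sqrt (score β X b S)) := by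
        refine Finset.sum_le_sum fun b _ => ?_
        linarith [abs_sub_le (emp X b S) (medOf X S) (probS p S), abs_emp_sub_medOf_le β X b S]
    _ ≤ _ := by
        rw [Finset.sum_add_distrib, Finset.sum_const, nsmul_eq_mul]
        linarith [sum_sqrt_score_le β X A S]

theorem sum_emp_sub {m n k : ℕ} (X : Fin m → Fin n → Fin k) {B' : Finset (Fin m)}
    (hB : B'.Nonempty) (S : Finset (Fin k)) (c : ℝ) :
    ∑ b ∈ B', (emp X b S - c) = B'.card * (pbar X B' S - c) := by
  have : (B'.card : ℝ) ≠ 0 := by exact_mod_cast hB.card_pos.ne'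
  rw [Finset.sum_sub_distrib, Finset.sum_const, nsmul_eq_mul, pbar]
  field_simp

theorem psi_le_psiMax {m n k : ℕ} (β : ℝ) (X : Fin m → Fin n → Fin k) {A B' : Finset (Fin m)}
    (hA : A ⊆ B') (S : Finset (Fin k)) : psi β X A S ≤ psiMax β X B' :=
  (Finset.sum_le_sum_of_subset_of_nonneg hA fun b _ _ => score_nonneg β X b S).trans
    (Finset.le_sup' (fun S => psi β X B' S) (Finset.mem_univ S))

/-- Size of the adversarial part `a` and of the total number `m` relative to `g + a`, where `g` is
the number of retained good batches. -/
theorem card_ratio_bounds {β m g a : ℝ} (hβ0 : 0 < β) (hβ : β ≤ 0.4) (hm : 0 ≤ m)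
    (ha0 : 0 ≤ a) (hg : (1 - β / 6) * ((1 - β) * m) ≤ g) (ha : a ≤ β * m) :
    a ≤ 1.05 * β * (g + a) ∧ 0.56 * m ≤ g + a := by
  norm_num at hβ
  have hβm : 0 ≤ β * m := by positivity
  constructor
  · have e₁ : 0 ≤ (20 - 21 * β) * (β * m - a) :=
      mul_nonneg (by linarith) (by linarith)
    have e₂ := mul_le_mul_of_nonneg_left hg hβ0.le
    have e₃ : 0 ≤ β * m * (1 - 3.5 * β + 3.5 * β ^ 2) :=
      mul_nonneg hβm (by nlinarith [sq_nonneg (β - 1 / 2)])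
    nlinarith
  · have e : 0 ≤ m * ((1 - β / 6) * (1 - β) - 0.56) :=
      mul_nonneg hm (by nlinarith)
    nlinarith

theorem abs_pbar_sub_probS_le {k n m : ℕ} {β : ℝ} (hβ0 : 0 < β) (hβ : β ≤ 0.4)
    {X : Fin m → Fin n → Fin k} {p : Fin k → ℝ} {BG : Finset (Fin m)}
    (hBG : (1 - β) * (m : ℝ) ≤ (BG.card : ℝ))
    (hBA : ((Finset.univ \ BG).card : ℝ) ≤ β * (m : ℝ))
    (h1 : Cond1 X p) (h2 : Cond2 β X p BG) {B' : Finset (Fin m)}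
    (hB' : (1 - β / 6) * (BG.card : ℝ) ≤ ((B' ∩ BG).card : ℝ))
    {t : ℝ} (ht : 0 ≤ t) (hpsi : psiMax β X B' = t * kappaG β m n) (S : Finset (Fin k)) :
    |pbar X B' S - probS p S| ≤ (5 + 3 / 2 * Real.sqrt t) * β *
      Real.sqrt (Real.log (6 * Real.exp 1 / β) / (n : ℝ)) := by
  have hβ1 : β ≤ 1 := by norm_num at hβ; linarith
  have hgood := (h2 S (B' ∩ BG) Finset.inter_subset_right hB').1
  have hbad := abs_sum_emp_sub_le hβ0 hβ1 h1 (B' \ BG) S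
  have hL : 0 ≤ Real.log (6 * Real.exp 1 / β) / (n : ℝ) :=
    div_nonneg ((Real.log_nonneg (by norm_num)).trans (log_six_le hβ0 hβ1)) (Nat.cast_nonneg n)
  have hκ : kappaG β m n = β * m * (Real.log (6 * Real.exp 1 / β) / (n : ℝ)) := by
    unfold kappaG; ring
  have hψ := psi_le_psiMax β X (Finset.sdiff_subset : B' \ BG ⊆ B') S
  rw [hpsi, hκ] at hψ
  generalize Real.log (6 * Real.exp 1 / β) / (n : ℝ) = L at *
  set s := Real.sqrt L with hs
  have hs0 : 0 ≤ s := Real.sqrt_nonneg _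
  have hsL : s ^ 2 = L := Real.sq_sqrt hL
  have hr0 : 0 ≤ Real.sqrt t := Real.sqrt_nonneg _
  have hrt : Real.sqrt t ^ 2 = t := Real.sq_sqrt ht
  rcases B'.eq_empty_or_nonempty with rfl | hne
  · rw [Finset.empty_inter] at hgood
    refine hgood.trans (mul_le_mul_of_nonneg_right ?_ hs0)
    nlinarith [mul_nonneg hr0 hβ0.le]
  have hcard : ((B' ∩ BG).card : ℝ) + ((B' \ BG).card : ℝ) = B'.card := by
    exact_mod_cast Finset.card_inter_add_card_sdiff B' BG
  have hgood_sum : |∑ b ∈ B' ∩ BG, (emp X b S - probS p S)| ≤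
      (B' ∩ BG).card * (β / 2 * s) := by
    rcases (B' ∩ BG).eq_empty_or_nonempty with h | h
    · simp [h]
    · rw [sum_emp_sub X h, abs_mul, Nat.abs_cast]
      exact mul_le_mul_of_nonneg_left hgood (Nat.cast_nonneg _)
  have htot : B'.card * |pbar X B' S - probS p S| ≤
      |∑ b ∈ B' ∩ BG, (emp X b S - probS p S)| + |∑ b ∈ B' \ BG, (emp X b S - probS p S)| := by
    rw [← Nat.abs_cast B'.card, ← abs_mul, ← sum_emp_sub X hne,
      ← Finset.sum_inter_add_sum_sdiff B' BG]
    exact abs_add_le _ _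
  have hbad_card : ((B' \ BG).card : ℝ) ≤ β * m := by
    refine le_trans ?_ hBA
    exact_mod_cast Finset.card_le_card (Finset.sdiff_subset_sdiff (Finset.subset_univ _) le_rfl)
  have hm0 : (0 : ℝ) ≤ m := Nat.cast_nonneg m
  have hg0 : (0 : ℝ) ≤ (B' ∩ BG).card := Nat.cast_nonneg _
  have ha0 : (0 : ℝ) ≤ (B' \ BG).card := Nat.cast_nonneg _
  obtain ⟨ha, hm⟩ := card_ratio_bounds hβ0 hβ hm0 ha0
    ((mul_le_mul_of_nonneg_left hBG (by linarith)).trans hB') hbad_card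
  rw [hcard] at ha hm
  have hN : (0 : ℝ) < B'.card := by exact_mod_cast hne.card_pos
  have ham : ((B' \ BG).card : ℝ) * m ≤ 9 / 4 * β * (B'.card : ℝ) ^ 2 := by
    have e₁ := mul_le_mul_of_nonneg_right ha hm0
    have e₂ := mul_le_mul_of_nonneg_left hm (mul_nonneg hβ0.le hN.le)
    have e₃ : 0 ≤ β * (B'.card : ℝ) ^ 2 := by positivity
    nlinarith
  have hsqrt : Real.sqrt ((B' \ BG).card * psi β X (B' \ BG) S) ≤
      3 / 2 * B'.card * β * Real.sqrt t * s := by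
    apply Real.sqrt_le_iff.2 ⟨by positivity, ?_⟩
    calc ((B' \ BG).card : ℝ) * psi β X (B' \ BG) S
        ≤ (B' \ BG).card * (t * (β * m * L)) := mul_le_mul_of_nonneg_left hψ ha0
      _ = ((B' \ BG).card * m) * (t * β * L) := by ring
      _ ≤ (9 / 4 * β * (B'.card : ℝ) ^ 2) * (t * β * L) :=
          mul_le_mul_of_nonneg_right ham (by positivity)
      _ = (3 / 2 * B'.card * β * Real.sqrt t * s) ^ 2 := by
          rw [← hsL]; nth_rewrite 1 [← hrt]; ring
  have e₁ := mul_le_mul_of_nonneg_right ha hs0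
  have e₂ : ((B' ∩ BG).card : ℝ) * (β / 2 * s) ≤ B'.card * (β / 2 * s) :=
    mul_le_mul_of_nonneg_right (by linarith) (by positivity)
  have e₃ : 0 ≤ β * B'.card * s := by positivity
  refine le_of_mul_le_mul_left ?_ hN
  nlinarith

/-- Lemma 2 of the paper. Assuming `β ≤ 0.4` and Conditions 1-3,
for any `B' ⊆ B` with `|B' ∩ BG| ≥ (1 - β/6)|BG|` and `ψ(B') = t·κ_G` (`t ≥ 0`),
`‖p̄_{B'} - p‖₁ ≤ (10 + 3√t)·β·√(ln(6e/β)/n)`. -/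
theorem corruption_and_L1 {k n m : ℕ} (β : ℝ) (hβ0 : 0 < β) (hβ : β ≤ 0.4)
    (X : Fin m → Fin n → Fin k) (p : Fin k → ℝ)
    (hp0 : ∀ i, 0 ≤ p i) (hp1 : ∑ i, p i = 1)
    (BG : Finset (Fin m)) (hBG : (1 - β) * (m : ℝ) ≤ (BG.card : ℝ))
    (hBA : ((Finset.univ \ BG).card : ℝ) ≤ β * (m : ℝ))
    (h1 : Cond1 X p) (h2 : Cond2 β X p BG) (h3 : Cond3 β X BG)
    (B' : Finset (Fin m))
    (hB' : (1 - β / 6) * (BG.card : ℝ) ≤ ((B' ∩ BG).card : ℝ))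
    (t : ℝ) (ht : 0 ≤ t) (hpsi : psiMax β X B' = t * kappaG β m n) :
    ∑ i : Fin k, |pbar X B' {i} - p i| ≤
      (10 + 3 * Real.sqrt t) * β *
        Real.sqrt (Real.log (6 * Real.exp 1 / β) / (n : ℝ)) := by
  have key := sum_abs_le_two_mul_of_forall_abs_sum_le (fun i => pbar X B' {i} - p i) fun S => by
    rw [Finset.sum_sub_distrib, sum_pbar_singleton]
    exact abs_pbar_sub_probS_le hβ0 hβ hBG hBA h1 h2 hB' ht hpsi S
  exact key.trans_eq (by ring)
end

section
/- Suppose Conditions 1 and 3 hold. Let B' ⊆ B, let S ⊆ [k], and suppose ψ(B', S) = t·κ_G for some t ≥ 0. Then (t − 3 − 2√t)·κ_G ≤ Σ_{b ∈ B' ∩ B_A} (μ̄_b(S) − p(S))² ≤ (t + 17 + 2√t)·κ_G. -/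
open Finset

theorem score_eq_zero_or {m n k : ℕ} (β : ℝ) (X : Fin m → Fin n → Fin k)
    (b : Fin m) (S : Finset (Fin k)) :
    (score β X b S = 0 ∧
      |emp X b S - medOf X S| ≤ 3 * Real.sqrt (Real.log (6 * Real.exp 1 / β) / (n : ℝ))) ∨
    score β X b S = (emp X b S - medOf X S) ^ 2 := by
  unfold score
  split_ifs with h
  · exact Or.inl ⟨rfl, h⟩
  · exact Or.inr rfl

/-- Weighted AM-GM, absolute value form. -/
theorem two_mul_abs_mul_le {a d r L : ℝ} (hr : 0 < r) (hd : d ^ 2 ≤ L) :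
    |2 * a * d| ≤ a ^ 2 / r + r * L := by
  have h1 : 0 ≤ (a - r * d) ^ 2 / r := by positivity
  have h2 : 0 ≤ (a + r * d) ^ 2 / r := by positivity
  have e1 : (a - r * d) ^ 2 / r = a ^ 2 / r - 2 * a * d + r * d ^ 2 := by
    field_simp
    ring
  have e2 : (a + r * d) ^ 2 / r = a ^ 2 / r + 2 * a * d + r * d ^ 2 := by
    field_simp
    ring
  have h3 := mul_le_mul_of_nonneg_left hd hr.le
  rw [abs_le]
  constructor <;> linarith

theorem add_sq_le_of_abs_le {a d L : ℝ} (hL : 0 ≤ L) (ha : |a| ≤ 3 * Real.sqrt L)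
    (hd : |d| ≤ Real.sqrt L) : (a + d) ^ 2 ≤ 16 * L := by
  have h : |a + d| ≤ 4 * Real.sqrt L := by linarith [abs_add_le a d]
  have h2 := pow_le_pow_left₀ (abs_nonneg _) h 2
  rw [sq_abs, mul_pow, Real.sq_sqrt hL] at h2
  linarith

theorem log_div_le_log_div {β : ℝ} (hβ0 : 0 < β) (hβ1 : β < 1) (n : ℕ) :
    Real.log 6 / (n : ℝ) ≤ Real.log (6 * Real.exp 1 / β) / (n : ℝ) := by
  have h : (6 : ℝ) ≤ 6 * Real.exp 1 / β := by
    rw [le_div_iff₀ hβ0]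
    have := Real.add_one_le_exp (1 : ℝ)
    linarith
  gcongr

/-- Lemma 5 of the paper. Assuming Conditions 1 and 3, for any
`B' ⊆ B`, `S ⊆ [k]`, with `ψ(B', S) = t·κ_G` (`t ≥ 0`), the total squared
deviation of the adversarial batches of `B'` satisfies
`(t - 3 - 2√t)·κ_G ≤ Σ_{b ∈ B' ∩ B_A} (μ̄_b(S) - p(S))² ≤ (t + 17 + 2√t)·κ_G`. -/
theorem adversarial_squared_deviation {k n m : ℕ} (β : ℝ) (hβ0 : 0 < β)
    (hβ1 : β < 1)
    (X : Fin m → Fin n → Fin k) (p : Fin k → ℝ)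
    (hp0 : ∀ i, 0 ≤ p i) (hp1 : ∑ i, p i = 1)
    (BG : Finset (Fin m)) (hBG : (1 - β) * (m : ℝ) ≤ (BG.card : ℝ))
    (hBA : ((Finset.univ \ BG).card : ℝ) ≤ β * (m : ℝ))
    (h1 : Cond1 X p) (h3 : Cond3 β X BG)
    (B' : Finset (Fin m)) (S : Finset (Fin k))
    (t : ℝ) (ht : 0 ≤ t) (hpsi : psi β X B' S = t * kappaG β m n) :
    (t - 3 - 2 * Real.sqrt t) * kappaG β m n ≤
        ∑ b ∈ B' ∩ (Finset.univ \ BG), (emp X b S - probS p S) ^ 2 ∧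
      ∑ b ∈ B' ∩ (Finset.univ \ BG), (emp X b S - probS p S) ^ 2 ≤
        (t + 17 + 2 * Real.sqrt t) * kappaG β m n := by
  classical
  set L : ℝ := Real.log (6 * Real.exp 1 / β) / (n : ℝ) with hL
  have hlog := log_div_le_log_div hβ0 hβ1 n
  have hL0 : 0 ≤ L := le_trans (by have := Real.log_nonneg (x := 6) (by norm_num); positivity) hlog
  have hd : |medOf X S - probS p S| ≤ Real.sqrt L := (h1 S).trans (Real.sqrt_le_sqrt hlog)
  have hd2 : (medOf X S - probS p S) ^ 2 ≤ L := by
    rw [← sq_abs, ← Real.sq_sqrt hL0]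
    gcongr
  have hκ : kappaG β m n = β * m * L := mul_div_assoc _ _ _
  have hκ0 : 0 ≤ kappaG β m n := by rw [hκ]; positivity
  have hdev : ∀ b, (emp X b S - probS p S) ^ 2 =
      ((emp X b S - medOf X S) + (medOf X S - probS p S)) ^ 2 := fun b => by ring
  set A := B' ∩ (Finset.univ \ BG) with hA
  have hcard : (A.card : ℝ) * L ≤ kappaG β m n := by
    rw [hκ]
    refine mul_le_mul_of_nonneg_right (le_trans ?_ hBA) hL0
    exact_mod_cast card_le_card inter_subset_right
  have hsplit : psi β X (B' ∩ BG) S + psi β X A S = t * kappaG β m n := by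
    rw [← hpsi, hA, ← compl_eq_univ_sdiff, ← sdiff_eq_inter_compl]
    exact sum_inter_add_sum_sdiff B' BG _
  have hgood : psi β X (B' ∩ BG) S ≤ kappaG β m n :=
    (sum_le_sum_of_subset_of_nonneg inter_subset_right
      fun b _ _ => score_nonneg β X b S).trans (h3 S)
  have hgood0 : 0 ≤ psi β X (B' ∩ BG) S := sum_nonneg fun b _ => score_nonneg β X b S
  have hA0 : 0 ≤ psi β X A S := sum_nonneg fun b _ => score_nonneg β X b S
  have hdev0 : 0 ≤ ∑ b ∈ A, (emp X b S - probS p S) ^ 2 := sum_nonneg fun b _ => sq_nonneg _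
  rcases ht.eq_or_lt with rfl | htpos
  · rw [Real.sqrt_zero]
    refine ⟨by linarith, ?_⟩
    have hzero : psi β X A S = 0 := by linarith
    have hscore := (sum_eq_zero_iff_of_nonneg fun b _ => score_nonneg β X b S).1 hzero
    have hle : ∑ b ∈ A, (emp X b S - probS p S) ^ 2 ≤ ∑ _b ∈ A, 16 * L := by
      refine sum_le_sum fun b hb => ?_
      rw [hdev]
      rcases score_eq_zero_or β X b S with ⟨-, h⟩ | h
      · exact add_sq_le_of_abs_le hL0 h hd
      · rw [hscore b hb] at h
        rw [pow_eq_zero_iff two_ne_zero |>.1 h.symm, zero_add]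
        linarith
    rw [sum_const, nsmul_eq_mul] at hle
    linarith
  · set r := Real.sqrt t with hr
    have hr0 : 0 < r := Real.sqrt_pos.2 htpos
    have hcross : psi β X A S / r ≤ r * kappaG β m n := by
      rw [div_le_iff₀ hr0]
      have : r * r = t := Real.mul_self_sqrt ht
      calc psi β X A S ≤ r * r * kappaG β m n := by rw [this]; linarith
        _ = r * kappaG β m n * r := by ring
    have hrcard := mul_le_mul_of_nonneg_left hcard hr0.le
    have hrL : 0 ≤ r * L := by positivity
    constructor
    · have hle : ∑ b ∈ A, (score β X b S - score β X b S / r - r * L) ≤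
          ∑ b ∈ A, (emp X b S - probS p S) ^ 2 := by
        refine sum_le_sum fun b _ => ?_
        rw [hdev]
        rcases score_eq_zero_or β X b S with ⟨h, -⟩ | h
        · rw [h, zero_div]
          linarith [sq_nonneg (emp X b S - medOf X S + (medOf X S - probS p S))]
        · have := (abs_le.1 (two_mul_abs_mul_le (a := emp X b S - medOf X S) hr0 hd2)).1
          rw [h, add_sq]
          linarith [sq_nonneg (medOf X S - probS p S)]
      rw [sum_sub_distrib, sum_sub_distrib, ← sum_div, sum_const, nsmul_eq_mul] at hle
      change psi β X A S - psi β X A S / r - _ ≤ _ at hle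
      linarith
    · have hle : ∑ b ∈ A, (emp X b S - probS p S) ^ 2 ≤
          ∑ b ∈ A, (score β X b S + score β X b S / r + (r * L + 16 * L)) := by
        refine sum_le_sum fun b _ => ?_
        rw [hdev]
        rcases score_eq_zero_or β X b S with ⟨h, h'⟩ | h
        · rw [h, zero_div]
          linarith [add_sq_le_of_abs_le hL0 h' hd]
        · have := (abs_le.1 (two_mul_abs_mul_le (a := emp X b S - medOf X S) hr0 hd2)).2
          rw [h, add_sq]
          linarith
      rw [sum_add_distrib, sum_add_distrib, ← sum_div, sum_const, nsmul_eq_mul] at hle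
      change _ ≤ psi β X A S + psi β X A S / r + _ at hle
      linarith
end
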